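/- Any complex matrix of the form 𝒜 = [𝒜_0 𝒜_1 𝒜_1*] with 𝒜_0 real admits a singular value decomposition 𝒜 = 𝒰 𝒮 𝒱^H where 𝒰 is a real orthogonal matrix, 𝒮 = diag(𝒮_1, 0) with 𝒮_1 diagonal positive definite of size r = rank 𝒜, and 𝒱 = [𝒱_0 𝒱_1 𝒱_1*]^H with 𝒱_0 real, satisfying 𝒱^H 𝒱 = I. -/

import Mathlib

open Matrix Complex

theorem aux_rank_blocks (a b : ℕ) :
    (fromBlocks 1 0 0 0 : Matrix (Fin a ⊕ Fin b) (Fin a ⊕ Fin b) ℂ).rank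
      = (fromBlocks 1 0 0 0 : Matrix (Fin a ⊕ Fin b) (Fin a ⊕ Fin b) ℝ).rank := by
  classical
  rw [← diagonal_one, ← diagonal_zero, fromBlocks_diagonal, rank_diagonal]
  rw [← diagonal_one, ← diagonal_zero, fromBlocks_diagonal, rank_diagonal]
  refine Fintype.card_congr (Equiv.subtypeEquivRight ?_)
  rintro (i | i) <;> simp

open scoped ComplexOrder in
theorem aux_rank_map {n : ℕ} {J : Type*} [Fintype J] [DecidableEq J] (B : Matrix (Fin n) J ℝ) :
    (B.map Complex.ofReal).rank = B.rank := by
  rw [← rank_self_mul_conjTranspose, ← rank_self_mul_transpose B]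
  have h1 : B.map Complex.ofReal * (B.map Complex.ofReal)ᴴ = (B * Bᵀ).map Complex.ofReal := by
    ext i j
    simp [Matrix.mul_apply]
  rw [h1]
  obtain ⟨V, U, e, hV, hU, hM⟩ := exists_rank_normal_form (B * Bᵀ)
  have hV' := (isUnit_iff_isUnit_det _).1 (hV.map (Complex.ofRealHom.mapMatrix (m := Fin n)))
  have hU' := (isUnit_iff_isUnit_det _).1 (hU.map (Complex.ofRealHom.mapMatrix (m := Fin n)))
  have hM' := congrArg (Complex.ofRealHom.mapMatrix (m := Fin n)) hM
  rw [map_mul, map_mul] at hM'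
  change _ * (B * Bᵀ).map Complex.ofReal * _ = _ at hM'
  have e1 := rank_mul_eq_left_of_isUnit_det _
    (Complex.ofRealHom.mapMatrix V * (B * Bᵀ).map Complex.ofReal) hU'
  rw [rank_mul_eq_right_of_isUnit_det _ _ hV', hM'] at e1
  have e2 := rank_mul_eq_left_of_isUnit_det _ (V * (B * Bᵀ)) ((isUnit_iff_isUnit_det _).1 hU)
  rw [rank_mul_eq_right_of_isUnit_det _ _ ((isUnit_iff_isUnit_det _).1 hV), hM] at e2
  rw [← e1]
  refine Eq.trans ?_ e2
  rw [rank_submatrix, ← aux_rank_blocks, ← rank_submatrix _ e e]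
  congr 1
  ext i j
  rw [RingHom.mapMatrix_apply, map_apply, submatrix_apply, submatrix_apply]
  rcases e i with a | a <;> rcases e j with b | b <;> simp [one_apply, apply_ite]

theorem aux_eig {n : ℕ} {J : Type*} [Fintype J] [DecidableEq J] (B : Matrix (Fin n) J ℝ) :
    ∃ (d : Fin n → ℝ) (u : Fin n → Fin n → ℝ),
      (∀ i : Fin n, (i : ℕ) < B.rank → 0 < d i) ∧
      (∀ i : Fin n, B.rank ≤ (i : ℕ) → d i = 0) ∧
      (∀ i j, u i ⬝ᵥ u j = if i = j then 1 else 0) ∧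
      (∀ i j, (Bᵀ *ᵥ u i) ⬝ᵥ (Bᵀ *ᵥ u j) = if i = j then d j else 0) := by
  have hps : (B * Bᵀ).PosSemidef := by
    simpa using posSemidef_self_mul_conjTranspose B
  have hr : B.rank = Fintype.card {i // hps.1.eigenvalues i ≠ 0} := by
    rw [← hps.1.rank_eq_card_non_zero_eigs, rank_self_mul_transpose]
  have hrn : B.rank ≤ n := by
    simpa using B.rank_le_card_height
  obtain ⟨r, hrr⟩ : ∃ r, B.rank = r := ⟨_, rfl⟩
  rw [hrr] at hr hrn ⊢
  have hc : Fintype.card {i : Fin n // (i : ℕ) < r} = Fintype.card {i // hps.1.eigenvalues i ≠ 0} := by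
    rw [← hr, Fintype.card_subtype]
    have : (Finset.univ.filter fun i : Fin n => (i : ℕ) < r) = Finset.univ.map (Fin.castLEEmb hrn) := by
      ext i
      simp only [Finset.mem_filter, Finset.mem_univ, true_and, Finset.mem_map, Fin.castLEEmb_apply]
      constructor
      · intro h; exact ⟨⟨i, h⟩, by ext; simp⟩
      · rintro ⟨a, rfl⟩; simp
    rw [this]; simp
  let σ := (Fintype.equivOfCardEq hc).extendSubtype
  let b := hps.1.eigenvectorBasis
  let d : Fin n → ℝ := fun i => hps.1.eigenvalues (σ i)
  let u : Fin n → Fin n → ℝ := fun i => ⇑(b (σ i))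
  have hd1 : ∀ i : Fin n, (i : ℕ) < r → 0 < d i := fun i hi =>
    lt_of_le_of_ne (hps.eigenvalues_nonneg _)
      (Ne.symm ((Fintype.equivOfCardEq hc).extendSubtype_mem i hi))
  have hd0 : ∀ i : Fin n, r ≤ (i : ℕ) → d i = 0 := fun i hi =>
    not_not.1 ((Fintype.equivOfCardEq hc).extendSubtype_not_mem i (not_lt.2 hi))
  have hu : ∀ i j, u i ⬝ᵥ u j = if i = j then 1 else 0 := by
    intro i j
    have := orthonormal_iff_ite.1 b.orthonormal (σ j) (σ i)
    simp only [EuclideanSpace.inner_eq_star_dotProduct, star_trivial, σ.injective.eq_iff] at this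
    refine Eq.trans this ?_
    by_cases h : i = j
    · simp [h]
    · simp [h, Ne.symm h]
  have hBu : ∀ i, (B * Bᵀ) *ᵥ u i = d i • u i := fun i => hps.1.mulVec_eigenvectorBasis (σ i)
  have hin : ∀ i j, (Bᵀ *ᵥ u i) ⬝ᵥ (Bᵀ *ᵥ u j) = if i = j then d j else 0 := by
    intro i j
    have : (Bᵀ *ᵥ u i) ⬝ᵥ (Bᵀ *ᵥ u j) = u i ⬝ᵥ ((B * Bᵀ) *ᵥ u j) := by
      rw [mulVec_transpose, ← dotProduct_mulVec, mulVec_mulVec]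
    rw [this, hBu, dotProduct_smul, hu]
    split_ifs <;> simp
  exact ⟨d, u, hd1, hd0, hu, hin⟩

theorem aux_svd {n : ℕ} {J : Type*} [Fintype J] [DecidableEq J] {p : ℕ} (eJ : J ≃ Fin p)
    (B : Matrix (Fin n) J ℝ) :
    ∃ (U : Matrix (Fin n) (Fin n) ℝ) (S : Matrix (Fin n) J ℝ) (W : Matrix J J ℝ),
      Uᵀ * U = 1 ∧ (∀ (i : Fin n) (j : J), (i : ℕ) ≠ (eJ j : ℕ) → S i j = 0) ∧
      (∀ (i : Fin n) (j : J), (i : ℕ) = (eJ j : ℕ) →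
        ((i : ℕ) < B.rank → 0 < S i j) ∧ (B.rank ≤ (i : ℕ) → S i j = 0)) ∧
      W * Wᵀ = 1 ∧ B = U * S * W := by
  obtain ⟨d, u, hd1, hd0, hu, hin⟩ := aux_eig B
  have hrn : B.rank ≤ n := by
    simpa using B.rank_le_card_height
  have hrp : B.rank ≤ p := by
    have := B.rank_le_card_width
    rwa [Fintype.card_congr eJ, Fintype.card_fin] at this
  obtain ⟨r, hrr⟩ : ∃ r, B.rank = r := ⟨_, rfl⟩
  rw [hrr] at hd1 hd0 hrn hrp ⊢
  let v : J → EuclideanSpace ℝ J := fun j =>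
    if h : (eJ j : ℕ) < n then WithLp.toLp 2 ((√(d ⟨eJ j, h⟩))⁻¹ • (Bᵀ *ᵥ u ⟨eJ j, h⟩)) else 0
  let s : Set J := {j | (eJ j : ℕ) < r}
  have hv : Orthonormal ℝ (s.domRestrict v) := by
    rw [orthonormal_iff_ite]
    rintro ⟨j, hj⟩ ⟨k, hk⟩
    change (eJ j : ℕ) < r at hj
    change (eJ k : ℕ) < r at hk
    have hj' : (eJ j : ℕ) < n := by omega
    have hk' : (eJ k : ℕ) < n := by omega
    change inner ℝ (v j) (v k) = _
    simp only [v, dif_pos hj', dif_pos hk', EuclideanSpace.inner_eq_star_dotProduct, star_trivial,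
      smul_dotProduct, dotProduct_smul, hin, Subtype.mk.injEq]
    by_cases hjk : j = k
    · subst hjk
      have hp := hd1 ⟨eJ j, hj'⟩ hj
      have h2 := Real.mul_self_sqrt hp.le
      have h3 := (Real.sqrt_pos.2 hp).ne'
      simp only [if_true, smul_eq_mul]
      field_simp
      nlinarith
    · have : ¬ (⟨eJ k, hk'⟩ : Fin n) = ⟨eJ j, hj'⟩ := by
        intro h
        exact hjk (eJ.injective (Fin.ext (Fin.mk.inj_iff.1 h).symm))
      simp [this, hjk]
  obtain ⟨w, hw⟩ := hv.exists_orthonormalBasis_extension_of_card_eq finrank_euclideanSpace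
  let U : Matrix (Fin n) (Fin n) ℝ := Matrix.of fun i k => u k i
  have hU : Uᵀ * U = 1 := by
    ext i j
    rw [one_apply, ← hu]; rfl
  refine ⟨U, Matrix.of fun i j => if (i : ℕ) = eJ j then √(d i) else 0,
    Matrix.of fun j k => w j k, hU, ?_, ?_, ?_, ?_⟩
  · intro i j h
    simp [h]
  · intro i j h
    simp only [of_apply, if_pos h]
    exact ⟨fun hi => Real.sqrt_pos.2 (hd1 i hi), fun hi => by rw [hd0 i hi, Real.sqrt_zero]⟩
  · ext i j
    have := orthonormal_iff_ite.1 w.orthonormal j i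
    simp only [EuclideanSpace.inner_eq_star_dotProduct, star_trivial] at this
    refine Eq.trans this ?_
    rw [one_apply]
    by_cases h : i = j
    · simp [h]
    · simp [h, Ne.symm h]
  · have hU2 : U * Uᵀ = 1 := mul_eq_one_comm.1 hU
    have key : Uᵀ * B = (Matrix.of fun (i : Fin n) (j : J) => if (i : ℕ) = eJ j then √(d i) else 0)
        * (Matrix.of fun j k => w j k) := by
      ext i k
      have e1 : (Uᵀ * B) i k = (Bᵀ *ᵥ u i) k := by
        simp [Matrix.mul_apply, mulVec, dotProduct, U, mul_comm]
      rw [e1]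
      by_cases hi : (i : ℕ) < r
      · have hip : (i : ℕ) < p := by omega
        rw [mul_apply, Finset.sum_eq_single (eJ.symm ⟨i, hip⟩)]
        · rw [of_apply, of_apply, hw _ (by simpa [s] using hi)]
          simp only [v, Equiv.apply_symm_apply, if_true, Fin.is_lt, dif_pos, Fin.eta]
          have h3 := (Real.sqrt_pos.2 (hd1 i hi)).ne'
          simp [h3]
        · intro j _ hj
          rw [of_apply, if_neg, zero_mul]
          intro h
          exact hj (by rw [Equiv.eq_symm_apply]; exact Fin.ext h.symm)
        · simp
      · have hz : d i = 0 := hd0 i (not_lt.1 hi)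
        have h0 : Bᵀ *ᵥ u i = 0 := by
          rw [← dotProduct_self_eq_zero, hin]; simp [hz]
        rw [h0, mul_apply]
        simp [hz]
    rw [Matrix.mul_assoc, ← key, ← Matrix.mul_assoc, hU2, Matrix.one_mul]

/-- a matrix 𝒜 = [𝒜₀ 𝒜₁ 𝒜₁*] with 𝒜₀ real admits an SVD 𝒜 = 𝒰 𝒮 𝒱ᴴ with
    𝒰 real orthogonal, 𝒮 = diag(𝒮₁, 0) with 𝒮₁ positive diagonal of size r = rank 𝒜,
    and 𝒱ᴴ = [𝒱₀ 𝒱₁ 𝒱₁*] with 𝒱₀ real, 𝒱ᴴ𝒱 = I. -/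
theorem structured_svd (n m0 m1 : ℕ)
    (A0 : Matrix (Fin n) (Fin m0) ℝ) (A1 : Matrix (Fin n) (Fin m1) ℂ) :
    let A : Matrix (Fin n) (Fin m0 ⊕ (Fin m1 ⊕ Fin m1)) ℂ :=
      Matrix.of fun i => Sum.elim (fun j => (A0 i j : ℂ))
        (Sum.elim (fun j => A1 i j) (fun j => (starRingEnd ℂ) (A1 i j)))
    let eJ : (Fin m0 ⊕ (Fin m1 ⊕ Fin m1)) ≃ Fin (m0 + (m1 + m1)) :=
      (Equiv.sumCongr (Equiv.refl (Fin m0)) finSumFinEquiv).trans finSumFinEquiv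
    let r : ℕ := A.rank
    ∃ (U : Matrix (Fin n) (Fin n) ℝ)
      (S : Matrix (Fin n) (Fin m0 ⊕ (Fin m1 ⊕ Fin m1)) ℝ)
      (V0 : Matrix (Fin m0 ⊕ (Fin m1 ⊕ Fin m1)) (Fin m0) ℝ)
      (V1 : Matrix (Fin m0 ⊕ (Fin m1 ⊕ Fin m1)) (Fin m1) ℂ),
      Uᵀ * U = 1 ∧
      (∀ (i : Fin n) (j : Fin m0 ⊕ (Fin m1 ⊕ Fin m1)), (i : ℕ) ≠ (eJ j : ℕ) → S i j = 0) ∧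
      (∀ (i : Fin n) (j : Fin m0 ⊕ (Fin m1 ⊕ Fin m1)), (i : ℕ) = (eJ j : ℕ) →
        ((i : ℕ) < r → 0 < S i j) ∧ (r ≤ (i : ℕ) → S i j = 0)) ∧
      (let Vh : Matrix (Fin m0 ⊕ (Fin m1 ⊕ Fin m1)) (Fin m0 ⊕ (Fin m1 ⊕ Fin m1)) ℂ :=
        Matrix.of fun i => Sum.elim (fun j => (V0 i j : ℂ))
          (Sum.elim (fun j => V1 i j) (fun j => (starRingEnd ℂ) (V1 i j)))
       Vh * Vhᴴ = 1 ∧ A = (U.map Complex.ofReal) * (S.map Complex.ofReal) * Vh) := by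
  intro A eJ r
  let B : Matrix (Fin n) (Fin m0 ⊕ (Fin m1 ⊕ Fin m1)) ℝ :=
    Matrix.of fun i => Sum.elim (fun j => A0 i j)
      (Sum.elim (fun j => √2 * (A1 i j).re) (fun j => √2 * (A1 i j).im))
  have hs : (√2 : ℝ) * √2 = 2 := Real.mul_self_sqrt (by norm_num)
  have hsc : ((√2 : ℝ) : ℂ) * ((√2 : ℝ) : ℂ) = 2 := by
    rw [← Complex.ofReal_mul, hs]; norm_num
  have hs0 : ((√2 : ℝ) : ℂ) ≠ 0 := by
    intro h
    rw [h] at hsc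
    norm_num at hsc
  let Q : Matrix (Fin m0 ⊕ (Fin m1 ⊕ Fin m1)) (Fin m0 ⊕ (Fin m1 ⊕ Fin m1)) ℂ :=
    fromBlocks 1 0 0 (fromBlocks (((√2 : ℝ) : ℂ)⁻¹ • 1) (((√2 : ℝ) : ℂ)⁻¹ • 1)
      ((((√2 : ℝ) : ℂ)⁻¹ * I) • 1) ((-(((√2 : ℝ) : ℂ)⁻¹ * I)) • 1))
  have hQ : Q * Qᴴ = 1 := by
    have h1 : ((√2 : ℝ) : ℂ)⁻¹ * ((√2 : ℝ) : ℂ)⁻¹ = 1 / 2 := by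
      rw [← mul_inv, hsc]; norm_num
    simp only [Q, fromBlocks_conjTranspose, fromBlocks_multiply]
    rw [← fromBlocks_one, ← fromBlocks_one (l := Fin m1)]
    have h2 : ∀ a b : ℂ, (a • (1 : Matrix (Fin m1) (Fin m1) ℂ)) * (b • 1) = (a * b) • 1 := by
      intro a b; simp [smul_smul, mul_comm]
    have h3 : ∀ c : ℂ, (c • (1 : Matrix (Fin m1) (Fin m1) ℂ))ᴴ = star c • 1 := by
      intro c; simp
    have e1 : star (((√2 : ℝ) : ℂ)⁻¹) = ((√2 : ℝ) : ℂ)⁻¹ := by simp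
    have e2 : star (((√2 : ℝ) : ℂ)⁻¹ * I) = -(((√2 : ℝ) : ℂ)⁻¹ * I) := by simp
    have h0 : ∀ c : ℂ, c = 1 → c • (1 : Matrix (Fin m1) (Fin m1) ℂ) = 1 := by
      rintro _ rfl; simp
    have h00 : ∀ c : ℂ, c = 0 → c • (1 : Matrix (Fin m1) (Fin m1) ℂ) = 0 := by
      rintro _ rfl; simp
    simp only [conjTranspose_zero, Matrix.mul_zero, Matrix.zero_mul, add_zero, zero_add,
      conjTranspose_one, Matrix.mul_one, h3, h2, star_neg, e1, e2, ← add_smul]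
    congr 2
    · apply h0; linear_combination 2 * h1
    · apply h00; ring
    · apply h00; ring
    · apply h0
      linear_combination 2 * h1 - 2 * (((√2 : ℝ) : ℂ)⁻¹ * ((√2 : ℝ) : ℂ)⁻¹) * I_mul_I
  have hMQ : ∀ {k : Type} (M : Matrix k (Fin m0 ⊕ (Fin m1 ⊕ Fin m1)) ℝ),
      M.map Complex.ofReal * Q = Matrix.of fun i => Sum.elim (fun j => ((M i (Sum.inl j) : ℝ) : ℂ))
        (Sum.elim (fun j => ((√2 : ℝ) : ℂ)⁻¹ * (M i (Sum.inr (Sum.inl j)) + M i (Sum.inr (Sum.inr j)) * I))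
         (fun j => (starRingEnd ℂ)
          (((√2 : ℝ) : ℂ)⁻¹ * (M i (Sum.inr (Sum.inl j)) + M i (Sum.inr (Sum.inr j)) * I)))) := by
    intro k M
    ext i (j | j | j)
    · simp [Q, Matrix.mul_apply, Fintype.sum_sum_type, one_apply]
    · simp [Q, Matrix.mul_apply, Fintype.sum_sum_type, one_apply]
      ring
    · simp [Q, Matrix.mul_apply, Fintype.sum_sum_type, one_apply]
      ring
  have hA : A = B.map Complex.ofReal * Q := by
    rw [hMQ]
    have h1 : ∀ z : ℂ, z = ((√2 : ℝ) : ℂ)⁻¹ *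
        (((√2 * z.re : ℝ) : ℂ) + ((√2 * z.im : ℝ) : ℂ) * I) := by
      intro z
      conv_lhs => rw [← Complex.re_add_im z]
      push_cast
      field_simp
    ext i (j | j | j)
    · rfl
    · exact h1 _
    · exact congrArg (starRingEnd ℂ) (h1 _)
  have hr : r = B.rank := by
    have hQu : IsUnit Q.det := by
      rw [← isUnit_iff_isUnit_det]
      exact IsUnit.of_mul_eq_one _ hQ
    change A.rank = _
    rw [hA, rank_mul_eq_left_of_isUnit_det _ _ hQu, aux_rank_map]
  obtain ⟨U, S, W, hU, hS0, hS1, hW, hB⟩ := aux_svd eJ B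
  rw [← hr] at hS1
  refine ⟨U, S, Matrix.of fun i j => W i (Sum.inl j), Matrix.of fun i j => ((√2 : ℝ) : ℂ)⁻¹ *
    (W i (Sum.inr (Sum.inl j)) + W i (Sum.inr (Sum.inr j)) * I), hU, hS0, hS1, ?_⟩
  intro Vh
  have hV : Vh = W.map Complex.ofReal * Q := (hMQ W).symm
  have hWc : W.map Complex.ofReal * (W.map Complex.ofReal)ᴴ = 1 := by
    have := congrArg (Complex.ofRealHom.mapMatrix) hW
    rw [map_mul, map_one] at this
    rw [← this]
    congr 1
    ext i j
    simp
  constructor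
  · rw [hV, conjTranspose_mul, Matrix.mul_assoc, ← Matrix.mul_assoc Q, hQ, Matrix.one_mul, hWc]
  · rw [hA, hV, ← Matrix.mul_assoc]
    congr 1
    have := congrArg (fun M => M.map (Complex.ofRealHom)) hB
    simp only [Matrix.map_mul] at this
    exact this
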